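/- Let g, h, u₁, u₂, c be real numbers with g > 0 and h > 0, and let n = (n₁, n₂) ∈ ℝ² satisfy n₁² + n₂² = 1. Write un = u₁n₁ + u₂n₂. Then the set of (complex) eigenvalues of the normal flux Jacobian matrix A equals {un + √(g·h), un − √(g·h), un}; in particular all eigenvalues of A are real. -/

import Mathlib

open Matrix

/-- The normal flux Jacobian of the shallow water hydro-sediment system
(bed-update equation excluded), in conserved variables `(h, hu₁, hu₂, hc)`. -/
def swhsNormalJacobian (g h u₁ u₂ c n₁ n₂ : ℝ) : Matrix (Fin 4) (Fin 4) ℝ :=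
  let un := u₁ * n₁ + u₂ * n₂
  !![0, n₁, n₂, 0;
     g * h * n₁ - u₁ * un, un + u₁ * n₁, u₁ * n₂, 0;
     g * h * n₂ - u₂ * un, u₂ * n₁, un + u₂ * n₂, 0;
     -c * un, c * n₁, c * n₂, un]

/-- The characteristic determinant of the normal flux Jacobian, for an arbitrary normal. -/
theorem det_algebraMap_sub_swhsNormalJacobian (g h u₁ u₂ c n₁ n₂ : ℝ) (z : ℂ) :
    (algebraMap ℂ (Matrix (Fin 4) (Fin 4) ℂ) z -
      (swhsNormalJacobian g h u₁ u₂ c n₁ n₂).map Complex.ofReal).det =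
    (z - (u₁ * n₁ + u₂ * n₂)) ^ 2 *
      ((z - (u₁ * n₁ + u₂ * n₂)) ^ 2 - g * h * (n₁ ^ 2 + n₂ ^ 2)) := by
  simp [swhsNormalJacobian, Matrix.det_succ_row_zero, Fin.sum_univ_succ,
    Matrix.algebraMap_matrix_apply, Fin.succAbove]
  ring

/-- The set of complex eigenvalues of the normal flux Jacobian `A` of the shallow water
hydro-sediment system is `{un + √(gh), un − √(gh), un}`; in particular all eigenvalues
of `A` are real. -/
theorem swhs_normal_jacobian_eigenvalues
    (g h u₁ u₂ c n₁ n₂ : ℝ) (hg : 0 < g) (hh : 0 < h)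
    (hn : n₁ ^ 2 + n₂ ^ 2 = 1) (un : ℝ) (hun : un = u₁ * n₁ + u₂ * n₂) :
    spectrum ℂ ((swhsNormalJacobian g h u₁ u₂ c n₁ n₂).map (Complex.ofReal)) =
      {((un + Real.sqrt (g * h) : ℝ) : ℂ),
       ((un - Real.sqrt (g * h) : ℝ) : ℂ),
       ((un : ℝ) : ℂ)} ∧
    ∀ z ∈ spectrum ℂ ((swhsNormalJacobian g h u₁ u₂ c n₁ n₂).map (Complex.ofReal)),
      z.im = 0 := by
  have key (z : ℂ) :
      z ∈ spectrum ℂ ((swhsNormalJacobian g h u₁ u₂ c n₁ n₂).map (Complex.ofReal)) ↔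
        z = ((un + Real.sqrt (g * h) : ℝ) : ℂ) ∨ z = ((un - Real.sqrt (g * h) : ℝ) : ℂ) ∨
          z = (un : ℂ) := by
    have hn' : (n₁ : ℂ) ^ 2 + (n₂ : ℂ) ^ 2 = 1 := mod_cast hn
    have hs : ((Real.sqrt (g * h) : ℝ) : ℂ) ^ 2 = g * h :=
      mod_cast Real.sq_sqrt (mul_pos hg hh).le
    have hun' : (u₁ * n₁ + u₂ * n₂ : ℂ) = un := by rw [hun]; push_cast; rfl
    have hfactor : (z - un) ^ 2 * ((z - un) ^ 2 - g * h * 1) =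
        (z - (un + Real.sqrt (g * h) : ℝ)) * (z - (un - Real.sqrt (g * h) : ℝ)) *
          (z - un) ^ 2 := by
      push_cast
      linear_combination (z - un) ^ 2 * hs
    rw [spectrum.mem_iff, Matrix.isUnit_iff_isUnit_det, isUnit_iff_ne_zero, not_not,
      det_algebraMap_sub_swhsNormalJacobian, hn', hun', hfactor, mul_eq_zero, mul_eq_zero,
      sq_eq_zero_iff, sub_eq_zero, sub_eq_zero, sub_eq_zero, or_assoc]
  refine ⟨Set.ext key, fun z hz => ?_⟩
  rcases (key z).mp hz with rfl | rfl | rfl <;> exact Complex.ofReal_im _
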